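/- With the notation of the finite normal-mode expansion, ∫_{−H}^0 B(u,v,w;v)(z)·U_0(z) dz = (1/√H)·Σ_{m=0}^M (u_m·v^x_m + v_m·v^y_m) − (1/√H)·Σ_{m=1}^M λ_m·w_m·v_m. -/

import Mathlib

/-- The eigenvalue `λ_n = nπ/H`. -/
noncomputable def lamC (H : ℝ) (n : ℕ) : ℝ := n * Real.pi / H

/-- The cosine normal-mode eigenfunctions: `U_0(z) = 1/√H`,
`U_n(z) = √(2/H)·cos(λ_n z)` for `n ≥ 1`. -/
noncomputable def Ue (H : ℝ) (n : ℕ) (z : ℝ) : ℝ :=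
  if n = 0 then 1 / Real.sqrt H else Real.sqrt (2 / H) * Real.cos (lamC H n * z)

/-- The sine normal-mode eigenfunctions: `W_n(z) = √(2/H)·sin(λ_n z)`. -/
noncomputable def We (H : ℝ) (n : ℕ) (z : ℝ) : ℝ :=
  Real.sqrt (2 / H) * Real.sin (lamC H n * z)

/-- Finite cosine-mode expansion `Σ_{m=0}^M U_m(z)·c_m`. -/
noncomputable def cosExp (H : ℝ) (M : ℕ) (c : ℕ → ℝ) (z : ℝ) : ℝ :=
  ∑ m ∈ Finset.range (M + 1), Ue H m z * c m

/-- Finite sine-mode expansion `Σ_{m=1}^M W_m(z)·c_m`. -/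
noncomputable def sinExp (H : ℝ) (M : ℕ) (c : ℕ → ℝ) (z : ℝ) : ℝ :=
  ∑ m ∈ Finset.Icc 1 M, We H m z * c m

/-- `z`-derivative of the cosine-mode expansion: `−Σ_{m=1}^M λ_m W_m(z)·c_m`. -/
noncomputable def dzCosExp (H : ℝ) (M : ℕ) (c : ℕ → ℝ) (z : ℝ) : ℝ :=
  -∑ m ∈ Finset.Icc 1 M, lamC H m * We H m z * c m

/-- `z`-derivative of the sine-mode expansion: `Σ_{m=1}^M λ_m U_m(z)·c_m`. -/
noncomputable def dzSinExp (H : ℝ) (M : ℕ) (c : ℕ → ℝ) (z : ℝ) : ℝ :=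
  ∑ m ∈ Finset.Icc 1 M, lamC H m * Ue H m z * c m

theorem aux_int_cos (H : ℝ) (hH : 0 < H) (k : ℤ) :
    (∫ z in (-H)..0, Real.cos (k * Real.pi / H * z)) = if k = 0 then H else 0 := by
  split_ifs with hk
  · subst hk; simp
  · have hc : (k : ℝ) * Real.pi / H ≠ 0 := by
      have : (k : ℝ) ≠ 0 := by exact_mod_cast hk
      positivity
    rw [intervalIntegral.integral_comp_mul_left (fun x => Real.cos x) hc, integral_cos]
    have h1 : (k : ℝ) * Real.pi / H * -H = -(k * Real.pi) := by field_simp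
    rw [h1]
    simp [Real.sin_int_mul_pi]

theorem aux_cos_ii (H : ℝ) (c : ℝ) :
    IntervalIntegrable (fun z => Real.cos (c * z)) MeasureTheory.volume (-H) 0 :=
  Continuous.intervalIntegrable (by fun_prop) _ _

theorem aux_cc (H : ℝ) (hH : 0 < H) (m n : ℕ) :
    (∫ z in (-H)..0, Real.cos (lamC H m * z) * Real.cos (lamC H n * z))
      = ((if m = n then H else 0) + (if m + n = 0 then H else 0)) / 2 := by
  have h : ∀ z, Real.cos (lamC H m * z) * Real.cos (lamC H n * z)
      = (Real.cos (((m - n : ℤ) : ℝ) * Real.pi / H * z)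
        + Real.cos (((m + n : ℤ) : ℝ) * Real.pi / H * z)) / 2 := by
    intro z
    have e1 : ((m - n : ℤ) : ℝ) * Real.pi / H * z = lamC H m * z - lamC H n * z := by
      unfold lamC; push_cast; ring
    have e2 : ((m + n : ℤ) : ℝ) * Real.pi / H * z = lamC H m * z + lamC H n * z := by
      unfold lamC; push_cast; ring
    rw [e1, e2, Real.cos_sub, Real.cos_add]; ring
  simp_rw [h]
  rw [intervalIntegral.integral_div, intervalIntegral.integral_add (aux_cos_ii _ _)
    (aux_cos_ii _ _), aux_int_cos H hH, aux_int_cos H hH]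
  have a1 : ((m : ℤ) - n = 0) ↔ m = n := by omega
  have a2 : ((m : ℤ) + n = 0) ↔ m + n = 0 := by omega
  simp only [a1, a2]

theorem aux_ss (H : ℝ) (hH : 0 < H) (m n : ℕ) :
    (∫ z in (-H)..0, Real.sin (lamC H m * z) * Real.sin (lamC H n * z))
      = ((if m = n then H else 0) - (if m + n = 0 then H else 0)) / 2 := by
  have h : ∀ z, Real.sin (lamC H m * z) * Real.sin (lamC H n * z)
      = (Real.cos (((m - n : ℤ) : ℝ) * Real.pi / H * z)
        - Real.cos (((m + n : ℤ) : ℝ) * Real.pi / H * z)) / 2 := by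
    intro z
    have e1 : ((m - n : ℤ) : ℝ) * Real.pi / H * z = lamC H m * z - lamC H n * z := by
      unfold lamC; push_cast; ring
    have e2 : ((m + n : ℤ) : ℝ) * Real.pi / H * z = lamC H m * z + lamC H n * z := by
      unfold lamC; push_cast; ring
    rw [e1, e2, Real.cos_sub, Real.cos_add]; ring
  simp_rw [h]
  rw [intervalIntegral.integral_div, intervalIntegral.integral_sub (aux_cos_ii _ _)
    (aux_cos_ii _ _), aux_int_cos H hH, aux_int_cos H hH]
  have a1 : ((m : ℤ) - n = 0) ↔ m = n := by omega
  have a2 : ((m : ℤ) + n = 0) ↔ m + n = 0 := by omega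
  simp only [a1, a2]

theorem aux_Ue (H : ℝ) (n : ℕ) : Ue H n = fun z =>
    (if n = 0 then 1 / Real.sqrt H else Real.sqrt (2 / H)) * Real.cos (lamC H n * z) := by
  funext z
  unfold Ue
  split_ifs with h
  · subst h; simp [lamC]
  · rfl

theorem aux_Ue_cont (H : ℝ) (n : ℕ) : Continuous (Ue H n) := by
  rw [aux_Ue]; fun_prop

theorem aux_We_cont (H : ℝ) (n : ℕ) : Continuous (We H n) := by
  unfold We; fun_prop

theorem aux_UU (H : ℝ) (hH : 0 < H) (m n : ℕ) :
    (∫ z in (-H)..0, Ue H m z * Ue H n z) = if m = n then 1 else 0 := by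
  simp only [aux_Ue]
  rw [intervalIntegral.integral_congr (fun z _ => mul_mul_mul_comm _ _ _ _)]
  rw [intervalIntegral.integral_const_mul, aux_cc H hH]
  by_cases hmn : m = n
  · subst hmn
    by_cases hm : m = 0
    · have := Real.mul_self_sqrt hH.le
      have h0 : Real.sqrt H ≠ 0 := (Real.sqrt_pos.2 hH).ne'
      simp only [hm, if_true]
      field_simp
      nlinarith
    · have h2 := Real.mul_self_sqrt (show 0 ≤ 2 / H by positivity)
      have : m + m ≠ 0 := by omega
      simp only [hm, this, if_true, if_false, h2]
      field_simp
      norm_num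
  · have : m + n ≠ 0 := by omega
    rw [if_neg hmn, if_neg hmn, if_neg this]; simp

theorem aux_WW (H : ℝ) (hH : 0 < H) (m n : ℕ) (hm : m ≠ 0) :
    (∫ z in (-H)..0, We H m z * We H n z) = if m = n then 1 else 0 := by
  unfold We
  rw [intervalIntegral.integral_congr (fun z _ => mul_mul_mul_comm _ _ _ _)]
  rw [intervalIntegral.integral_const_mul, aux_ss H hH,
    Real.mul_self_sqrt (show 0 ≤ 2 / H by positivity)]
  have : m + n ≠ 0 := by omega
  by_cases hmn : m = n
  · simp only [this, hmn, if_true, if_false]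
    have : n + n ≠ 0 := by omega
    simp only [this, if_false]
    field_simp
    norm_num
  · simp [hmn, hm]

theorem aux_gen (s : Finset ℕ) (f : ℕ → ℝ → ℝ) (a b : ℝ) (hf : ∀ n, Continuous (f n))
    (ho : ∀ m ∈ s, ∀ n ∈ s, (∫ z in a..b, f m z * f n z) = if m = n then 1 else 0)
    (c d : ℕ → ℝ) :
    (∫ z in a..b, (∑ m ∈ s, f m z * c m) * (∑ n ∈ s, f n z * d n)) = ∑ m ∈ s, c m * d m := by
  have h : ∀ z, (∑ m ∈ s, f m z * c m) * (∑ n ∈ s, f n z * d n)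
      = ∑ m ∈ s, ∑ n ∈ s, (c m * d n) * (f m z * f n z) := by
    intro z
    rw [Finset.sum_mul_sum]
    refine Finset.sum_congr rfl fun m _ => Finset.sum_congr rfl fun n _ => by ring
  simp_rw [h]
  rw [intervalIntegral.integral_finsetSum]
  · refine Finset.sum_congr rfl fun m hm => ?_
    rw [intervalIntegral.integral_finsetSum]
    · rw [Finset.sum_eq_single m]
      · rw [intervalIntegral.integral_const_mul, ho m hm m hm]; simp
      · intro n hn hnm
        rw [intervalIntegral.integral_const_mul, ho m hm n hn, if_neg (Ne.symm hnm), mul_zero]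
      · intro h; exact absurd hm h
    · intro n _
      have := hf m
      have := hf n
      exact Continuous.intervalIntegrable (by fun_prop) _ _
  · intro m _
    exact Continuous.intervalIntegrable (by fun_prop) _ _

/-- Projection of the nonlinear term `B(u,v,w;v) = u·v_x + v·v_y + w·v_z` onto the
barotropic mode `U_0`.  Here `uc, vc, vcx, vcy, wc` are the normal-mode coefficients
(at a fixed point) of `u, v, ∂v/∂x, ∂v/∂y, w` respectively. -/
theorem B_v_proj_zero (H : ℝ) (hH : 0 < H) (M : ℕ) (hM : 1 ≤ M)
    (uc vc vcx vcy wc : ℕ → ℝ) :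
    (∫ z in (-H)..0,
        (cosExp H M uc z * cosExp H M vcx z + cosExp H M vc z * cosExp H M vcy z +
          sinExp H M wc z * dzCosExp H M vc z) * Ue H 0 z)
      = (1 / Real.sqrt H) * ∑ m ∈ Finset.range (M + 1), (uc m * vcx m + vc m * vcy m)
        - (1 / Real.sqrt H) * ∑ m ∈ Finset.Icc 1 M, lamC H m * wc m * vc m := by
  have hU := aux_Ue_cont H
  have hW := aux_We_cont H
  have cC : ∀ c, Continuous (cosExp H M c) := by
    intro c; unfold cosExp; fun_prop
  have cS : ∀ c, Continuous (sinExp H M c) := by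
    intro c; unfold sinExp; fun_prop
  have hD : ∀ z, dzCosExp H M vc z = sinExp H M (fun m => -(lamC H m * vc m)) z := by
    intro z
    unfold dzCosExp sinExp
    rw [← Finset.sum_neg_distrib]
    exact Finset.sum_congr rfl fun m _ => by ring
  have IC : ∀ c d, (∫ z in (-H)..0, cosExp H M c z * cosExp H M d z)
      = ∑ m ∈ Finset.range (M + 1), c m * d m := fun c d =>
    aux_gen _ (Ue H) _ _ hU (fun m _ n _ => aux_UU H hH m n) c d
  have IS : ∀ c d, (∫ z in (-H)..0, sinExp H M c z * sinExp H M d z)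
      = ∑ m ∈ Finset.Icc 1 M, c m * d m := fun c d =>
    aux_gen _ (We H) _ _ hW (fun m hm n _ => aux_WW H hH m n (by
      have := (Finset.mem_Icc.1 hm).1; omega)) c d
  have hU0 : ∀ z, Ue H 0 z = 1 / Real.sqrt H := fun z => by simp [Ue]
  have c1 := cC uc
  have c2 := cC vcx
  have c3 := cC vc
  have c4 := cC vcy
  have c5 := cS wc
  have c6 := cS (fun m => -(lamC H m * vc m))
  simp_rw [hD, hU0]
  rw [intervalIntegral.integral_mul_const, intervalIntegral.integral_add,
    intervalIntegral.integral_add, IC, IC, IS, Finset.sum_add_distrib]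
  · have : ∑ m ∈ Finset.Icc 1 M, wc m * -(lamC H m * vc m)
        = -∑ m ∈ Finset.Icc 1 M, lamC H m * wc m * vc m := by
      rw [← Finset.sum_neg_distrib]
      exact Finset.sum_congr rfl fun m _ => by ring
    rw [this]; ring
  all_goals exact Continuous.intervalIntegrable (by fun_prop) _ _
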